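/- Let d ≥ 1, ρ > 0, ε > 0, and let f : ℝ^d → ℝ be twice continuously differentiable and ρ-Hessian Lipschitz. If the smoothing parameter satisfies 0 < μ ≤ √(3ε/(2ρ√d)), then for every x ∈ ℝ^d one has ‖∇̂_coord f(x) − ∇f(x)‖ ≤ ε/4; consequently, if ‖∇̂_coord f(x)‖ ≤ 3ε/4 then ‖∇f(x)‖ ≤ ε, and if ‖∇̂_coord f(x)‖ > 3ε/4 then ‖∇f(x)‖ ≥ ε/2. -/

import Mathlib

/-- The central-difference coordinate-wise gradient estimator
`∇̂_coord f(x) = Σ_i ((f(x+μeᵢ) − f(x−μeᵢ))/(2μ)) eᵢ`. -/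
noncomputable def coordGrad (d : ℕ) (f : EuclideanSpace ℝ (Fin d) → ℝ) (μ : ℝ)
    (x : EuclideanSpace ℝ (Fin d)) : EuclideanSpace ℝ (Fin d) :=
  ∑ i : Fin d,
    ((f (x + μ • EuclideanSpace.single i 1) - f (x - μ • EuclideanSpace.single i 1)) / (2 * μ))
      • EuclideanSpace.single i 1

section CentralDifference

variable {E : Type*} [NormedAddCommGroup E] [NormedSpace ℝ E]

theorem hasDerivAt_comp_add_smul {F : Type*} [NormedAddCommGroup F] [NormedSpace ℝ F]
    {g : E → F} (hg : Differentiable ℝ g) (x v : E) (t : ℝ) :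
    HasDerivAt (fun s : ℝ => g (x + s • v)) (fderiv ℝ g (x + t • v) v) t := by
  have h : HasDerivAt (fun s : ℝ => x + s • v) v t := by
    simpa using ((hasDerivAt_id t).smul_const v).const_add x
  exact (hg (x + t • v)).hasFDerivAt.comp_hasDerivAt t h

theorem hasDerivAt_comp_sub_smul {F : Type*} [NormedAddCommGroup F] [NormedSpace ℝ F]
    {g : E → F} (hg : Differentiable ℝ g) (x v : E) (t : ℝ) :
    HasDerivAt (fun s : ℝ => g (x - s • v)) (-fderiv ℝ g (x - t • v) v) t := by
  simpa [sub_eq_add_neg] using hasDerivAt_comp_add_smul hg x (-v) t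

/-- The symmetric second difference of a map with `ρ`-Lipschitz derivative. -/
theorem norm_symmetric_difference_le {F : Type*} [NormedAddCommGroup F] [NormedSpace ℝ F]
    {g : E → F} (hg : Differentiable ℝ g) {ρ : ℝ}
    (hlip : ∀ x y : E, ‖fderiv ℝ g x - fderiv ℝ g y‖ ≤ ρ * ‖x - y‖)
    (x : E) {v : E} (hv : ‖v‖ = 1) {t : ℝ} (ht : 0 ≤ t) :
    ‖g (x + t • v) + g (x - t • v) - (2 : ℝ) • g x‖ ≤ ρ * t ^ 2 := by
  have hd : ∀ s : ℝ, HasDerivAt (fun s : ℝ => g (x + s • v) + g (x - s • v) - (2 : ℝ) • g x)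
      (fderiv ℝ g (x + s • v) v + -fderiv ℝ g (x - s • v) v) s := fun s =>
    ((hasDerivAt_comp_add_smul hg x v s).add (hasDerivAt_comp_sub_smul hg x v s)).sub_const _
  have hB : ∀ s : ℝ, HasDerivAt (fun s : ℝ => ρ * s ^ 2) (ρ * (2 * s)) s := fun s => by
    simpa using (hasDerivAt_pow 2 s).const_mul ρ
  refine image_norm_le_of_norm_deriv_right_le_deriv_boundary (a := 0) (b := t)
    (fun s _ => (hd s).continuousAt.continuousWithinAt) (fun s _ => (hd s).hasDerivWithinAt)
    (by simp [two_smul]) hB (fun s hs => ?_) ⟨ht, le_rfl⟩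
  have hdist : x + s • v - (x - s • v) = (2 * s) • v := by module
  calc ‖fderiv ℝ g (x + s • v) v + -fderiv ℝ g (x - s • v) v‖
      = ‖(fderiv ℝ g (x + s • v) - fderiv ℝ g (x - s • v)) v‖ := by
        simp [sub_eq_add_neg]
    _ ≤ ‖fderiv ℝ g (x + s • v) - fderiv ℝ g (x - s • v)‖ * ‖v‖ :=
        ContinuousLinearMap.le_opNorm _ _
    _ ≤ ρ * ‖x + s • v - (x - s • v)‖ := by
        rw [hv, mul_one]; exact hlip _ _
    _ = ρ * (2 * s) := by
        rw [hdist, norm_smul, hv, mul_one, Real.norm_of_nonneg (by linarith [hs.1])]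

end CentralDifference

section Gradient

variable {E : Type*} [NormedAddCommGroup E] [InnerProductSpace ℝ E] [CompleteSpace E]

theorem ContDiff.differentiable_gradient {f : E → ℝ} (hf : ContDiff ℝ 2 f) :
    Differentiable ℝ (gradient f) :=
  (InnerProductSpace.toDual ℝ E).symm.differentiable.comp
    ((hf.fderiv_right (m := 1) (by norm_num)).differentiable (by norm_num))

theorem abs_central_difference_sub_inner_gradient_le {f : E → ℝ} (hf : ContDiff ℝ 2 f) {ρ : ℝ}
    (hlip : ∀ x y : E, ‖fderiv ℝ (gradient f) x - fderiv ℝ (gradient f) y‖ ≤ ρ * ‖x - y‖)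
    (x : E) {v : E} (hv : ‖v‖ = 1) {μ : ℝ} (hμ : 0 < μ) :
    |(f (x + μ • v) - f (x - μ • v)) / (2 * μ) - inner ℝ (gradient f x) v| ≤ ρ * μ ^ 2 / 6 := by
  have hdf : Differentiable ℝ f := hf.differentiable (by norm_num)
  have hinner : ∀ y, fderiv ℝ f y v = inner ℝ (gradient f y) v := fun y => by
    simp [gradient]
  have hd : ∀ s : ℝ, HasDerivAt
      (fun s : ℝ => f (x + s • v) - f (x - s • v) - s * (2 * inner ℝ (gradient f x) v))
      (fderiv ℝ f (x + s • v) v - -fderiv ℝ f (x - s • v) v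
        - 1 * (2 * inner ℝ (gradient f x) v)) s := fun s =>
    ((hasDerivAt_comp_add_smul hdf x v s).sub (hasDerivAt_comp_sub_smul hdf x v s)).sub
      ((hasDerivAt_id s).mul_const _)
  have hB : ∀ s : ℝ, HasDerivAt (fun s : ℝ => ρ / 3 * s ^ 3) (ρ * s ^ 2) s := fun s => by
    refine ((hasDerivAt_pow 3 s).const_mul (ρ / 3)).congr_deriv ?_
    norm_num
    ring
  have key : ‖f (x + μ • v) - f (x - μ • v) - μ * (2 * inner ℝ (gradient f x) v)‖
      ≤ ρ / 3 * μ ^ 3 := by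
    refine image_norm_le_of_norm_deriv_right_le_deriv_boundary (a := 0) (b := μ)
      (f := fun s : ℝ => f (x + s • v) - f (x - s • v) - s * (2 * inner ℝ (gradient f x) v))
      (fun s _ => (hd s).continuousAt.continuousWithinAt) (fun s _ => (hd s).hasDerivWithinAt)
      (by simp) hB (fun s hs => ?_) ⟨hμ.le, le_rfl⟩
    calc ‖fderiv ℝ f (x + s • v) v - -fderiv ℝ f (x - s • v) v
          - 1 * (2 * inner ℝ (gradient f x) v)‖
        = ‖inner ℝ (gradient f (x + s • v) + gradient f (x - s • v)
            - (2 : ℝ) • gradient f x) v‖ := by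
          rw [hinner, hinner, inner_sub_left, inner_add_left, real_inner_smul_left]
          congr 1
          ring
      _ ≤ ‖gradient f (x + s • v) + gradient f (x - s • v) - (2 : ℝ) • gradient f x‖ * ‖v‖ :=
          norm_inner_le_norm _ _
      _ ≤ ρ * s ^ 2 := by
          rw [hv, mul_one]
          exact norm_symmetric_difference_le hf.differentiable_gradient hlip x hv hs.1
  have hrw : (f (x + μ • v) - f (x - μ • v)) / (2 * μ) - inner ℝ (gradient f x) v
      = (f (x + μ • v) - f (x - μ • v) - μ * (2 * inner ℝ (gradient f x) v)) / (2 * μ) := by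
    field_simp
  rw [hrw, abs_div, abs_of_pos (by positivity : 0 < 2 * μ), div_le_iff₀ (by positivity)]
  rw [Real.norm_eq_abs] at key
  linarith

end Gradient

theorem EuclideanSpace.norm_le_sqrt_card_mul {ι : Type*} [Fintype ι] (v : EuclideanSpace ℝ ι)
    {c : ℝ} (hc : 0 ≤ c) (hv : ∀ i, |v i| ≤ c) : ‖v‖ ≤ √(Fintype.card ι) * c := by
  rw [EuclideanSpace.norm_eq, ← Real.sqrt_sq hc, ← Real.sqrt_mul (Nat.cast_nonneg _)]
  refine Real.sqrt_le_sqrt ?_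
  calc ∑ i, ‖v i‖ ^ 2 ≤ ∑ _i : ι, c ^ 2 :=
        Finset.sum_le_sum fun i _ => pow_le_pow_left₀ (norm_nonneg _) (hv i) 2
    _ = Fintype.card ι * c ^ 2 := by simp

theorem coordGrad_apply (d : ℕ) (f : EuclideanSpace ℝ (Fin d) → ℝ) (μ : ℝ)
    (x : EuclideanSpace ℝ (Fin d)) (i : Fin d) :
    coordGrad d f μ x i =
      (f (x + μ • EuclideanSpace.single i 1) - f (x - μ • EuclideanSpace.single i 1))
        / (2 * μ) := by
  simp [coordGrad, Pi.single_apply]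

/-- Verifying an approximate first-order stationary point with the coordinate-wise estimator:
if `f : ℝ^d → ℝ` (`d ≥ 1`) is twice continuously differentiable and `ρ`-Hessian Lipschitz
(`ρ > 0`, `ε > 0`) and `0 < μ ≤ √(3ε/(2ρ√d))`, then `‖∇̂_coord f(x) − ∇f(x)‖ ≤ ε/4`;
consequently `‖∇̂_coord f(x)‖ ≤ 3ε/4 → ‖∇f(x)‖ ≤ ε` and
`‖∇̂_coord f(x)‖ > 3ε/4 → ‖∇f(x)‖ ≥ ε/2`. -/
theorem coordGrad_verify_gradient (d : ℕ) (hd : 1 ≤ d)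
    (f : EuclideanSpace ℝ (Fin d) → ℝ) (ρ ε : ℝ) (hρ : 0 < ρ) (hε : 0 < ε)
    (hf : ContDiff ℝ 2 f)
    (hHessLip : ∀ x y : EuclideanSpace ℝ (Fin d),
      ‖fderiv ℝ (gradient f) x - fderiv ℝ (gradient f) y‖ ≤ ρ * ‖x - y‖)
    (μ : ℝ) (hμ0 : 0 < μ) (hμ : μ ≤ Real.sqrt (3 * ε / (2 * ρ * Real.sqrt d)))
    (x : EuclideanSpace ℝ (Fin d)) :
    ‖coordGrad d f μ x - gradient f x‖ ≤ ε / 4 ∧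
      (‖coordGrad d f μ x‖ ≤ 3 * ε / 4 → ‖gradient f x‖ ≤ ε) ∧
      (‖coordGrad d f μ x‖ > 3 * ε / 4 → ‖gradient f x‖ ≥ ε / 2) := by
  have hbound : ‖coordGrad d f μ x - gradient f x‖ ≤ ε / 4 := by
    have hcoord : ∀ i, |(coordGrad d f μ x - gradient f x) i| ≤ ρ * μ ^ 2 / 6 := fun i => by
      have h := abs_central_difference_sub_inner_gradient_le hf hHessLip x
        (v := EuclideanSpace.single i (1 : ℝ)) (by simp) hμ0
      rw [EuclideanSpace.inner_single_right, one_mul, conj_trivial] at h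
      rwa [PiLp.sub_apply, coordGrad_apply]
    have hnorm := EuclideanSpace.norm_le_sqrt_card_mul _ (by positivity) hcoord
    rw [Fintype.card_fin] at hnorm
    have hsqrt : 0 < √(d : ℝ) := Real.sqrt_pos.2 (by exact_mod_cast hd)
    have hμsq : μ ^ 2 ≤ 3 * ε / (2 * ρ * √d) :=
      (Real.le_sqrt hμ0.le (by positivity)).1 hμ
    rw [le_div_iff₀ (by positivity)] at hμsq
    linarith
  refine ⟨hbound, fun h => ?_, fun h => ?_⟩
  · have := norm_le_norm_add_norm_sub (coordGrad d f μ x) (gradient f x)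
    linarith
  · have := norm_sub_norm_le (coordGrad d f μ x) (gradient f x)
    linarith
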